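/- arXiv:2108.08554 — 7 statements merged into one kernel-verified Lean document; each statement's English description precedes it below -/
import Mathlib

section
/- Let A ∈ ℝ^{m×n}, b ∈ ℝᵐ, let θ : ℝⁿ → ℝ be convex, X ⊆ ℝⁿ convex, Λ ⊆ ℝᵐ convex, r > 0, δ > 0, H₀ = (1/r) A Aᵀ + δ Iₘ, and let H be the block matrix H = [[r Iₙ, Aᵀ], [A, H₀]]. Suppose (xᵏ, λᵏ) ∈ ℝⁿ × ℝᵐ and that the new iterate (x^{k+1}, λ^{k+1}) satisfies: (i) x^{k+1} ∈ X and θ(x) − θ(x^{k+1}) + ⟨x − x^{k+1}, −Aᵀλᵏ + r(x^{k+1} − xᵏ)⟩ ≥ 0 for all x ∈ X (the optimality condition of the x-subproblem of the balanced ALM); (ii) λ^{k+1} ∈ Λ and ⟨λ − λ^{k+1}, (A(2x^{k+1} − xᵏ) − b) + H₀(λ^{k+1} − λᵏ)⟩ ≥ 0 for all λ ∈ Λ (the optimality condition of the λ-subproblem). Then, with F(x, λ) := (−Aᵀλ, Ax − b), w^{k+1} := (x^{k+1}, λ^{k+1}) ∈ X × Λ and for all w = (x, λ) ∈ X × Λ: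 θ(x) − θ(x^{k+1}) + ⟨w − w^{k+1}, F(w^{k+1})⟩ ≥ ⟨w − w^{k+1}, H(wᵏ − w^{k+1})⟩, where wᵏ = (xᵏ, λᵏ). -/
open Matrix

/-- Theorem 3.2 of the paper: the iterate `(x^{k+1}, λ^{k+1})` of the
balanced ALM, characterized by the first-order optimality conditions of its two
subproblems, satisfies the key variational inequality with the matrix
`H = [[r Iₙ, Aᵀ], [A, H₀]]`, `H₀ = (1/r) A Aᵀ + δ Iₘ`. -/
theorem stmt_4 {m n : ℕ} (A : Matrix (Fin m) (Fin n) ℝ) (b : Fin m → ℝ)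
    (θ : (Fin n → ℝ) → ℝ) (hθ : ConvexOn ℝ Set.univ θ)
    (X : Set (Fin n → ℝ)) (hX : Convex ℝ X)
    (Λ : Set (Fin m → ℝ)) (hΛ : Convex ℝ Λ)
    (r δ : ℝ) (hr : 0 < r) (hδ : 0 < δ)
    (H0 : Matrix (Fin m) (Fin m) ℝ)
    (hH0 : H0 = (1 / r) • (A * Aᵀ) + δ • (1 : Matrix (Fin m) (Fin m) ℝ))
    (H : Matrix (Fin n ⊕ Fin m) (Fin n ⊕ Fin m) ℝ)
    (hH : H = Matrix.fromBlocks (r • (1 : Matrix (Fin n) (Fin n) ℝ)) Aᵀ A H0)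
    (xk xn : Fin n → ℝ) (lk ln : Fin m → ℝ)
    (hxn : xn ∈ X)
    (hxVI : ∀ x ∈ X, θ x - θ xn + (x - xn) ⬝ᵥ (-(Aᵀ *ᵥ lk) + r • (xn - xk)) ≥ 0)
    (hln : ln ∈ Λ)
    (hlVI : ∀ l ∈ Λ, (l - ln) ⬝ᵥ ((A *ᵥ ((2 : ℝ) • xn - xk) - b) + H0 *ᵥ (ln - lk)) ≥ 0) :
    ∀ x ∈ X, ∀ l ∈ Λ,
      θ x - θ xn + ((x - xn) ⬝ᵥ (-(Aᵀ *ᵥ ln)) + (l - ln) ⬝ᵥ (A *ᵥ xn - b)) ≥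
        Sum.elim (x - xn) (l - ln) ⬝ᵥ (H *ᵥ Sum.elim (xk - xn) (lk - ln)) := by
  intro x hx l hl
  have h₁ := hxVI x hx
  have h₂ := hlVI l hl
  rw [hH, Matrix.fromBlocks_mulVec, sumElim_dotProduct_sumElim]
  simp only [Sum.elim_comp_inl, Sum.elim_comp_inr]
  generalize x - xn = u at *
  generalize l - ln = v at *
  simp only [Matrix.mulVec_sub, Matrix.mulVec_smul, Matrix.smul_mulVec, Matrix.one_mulVec,
    dotProduct_add, dotProduct_sub, dotProduct_neg, dotProduct_smul, smul_eq_mul] at h₁ h₂ ⊢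
  linarith
end

section
/- Let H be a symmetric positive semidefinite (n+m)×(n+m) matrix, θ : ℝⁿ → ℝ, and F(x, λ) := (−Aᵀλ, Ax − b) for given A ∈ ℝ^{m×n}, b ∈ ℝᵐ. Let Ω ⊆ ℝⁿ × ℝᵐ and suppose w^{k+1} = (x^{k+1}, λ^{k+1}) ∈ Ω and wᵏ ∈ ℝⁿ × ℝᵐ satisfy θ(x) − θ(x^{k+1}) + ⟨w − w^{k+1}, F(w^{k+1})⟩ ≥ ⟨w − w^{k+1}, H(wᵏ − w^{k+1})⟩ for all w = (x, λ) ∈ Ω. Then for all w = (x, λ) ∈ Ω: θ(x) − θ(x^{k+1}) + ⟨w − w^{k+1}, F(w)⟩ ≥ (1/2)(‖w − w^{k+1}‖²_H − ‖w − wᵏ‖²_H) + (1/2)‖wᵏ − w^{k+1}‖²_H. -/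
open Matrix

/-- The quadratic form `‖v‖²_H = vᵀ H v` associated with a matrix `H`. -/
def quadH {α : Type*} [Fintype α] (H : Matrix α α ℝ) (v : α → ℝ) : ℝ :=
  v ⬝ᵥ (H *ᵥ v)

/-- Polarization identity for a symmetric `H`. -/
theorem quadH_sub {α : Type*} [Fintype α] {H : Matrix α α ℝ} (hH : H.IsSymm) (u v : α → ℝ) :
    quadH H (u - v) = quadH H u - 2 * (u ⬝ᵥ (H *ᵥ v)) + quadH H v := by
  have hsymm : v ⬝ᵥ (H *ᵥ u) = u ⬝ᵥ (H *ᵥ v) := by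
    rw [dotProduct_mulVec, ← mulVec_transpose, hH.eq, dotProduct_comm]
  simp only [quadH, mulVec_sub, sub_dotProduct, dotProduct_sub, hsymm]
  ring

/-- The affine map `(x, l) ↦ (-Aᵀ l, A x - b)` has skew-symmetric linear part. -/
theorem dotProduct_affine_skew {ι κ : Type*} [Fintype ι] [Fintype κ] (A : Matrix κ ι ℝ)
    (b : κ → ℝ) (x x' : ι → ℝ) (l l' : κ → ℝ) :
    (x - x') ⬝ᵥ (-(Aᵀ *ᵥ l)) + (l - l') ⬝ᵥ (A *ᵥ x - b) =
      (x - x') ⬝ᵥ (-(Aᵀ *ᵥ l')) + (l - l') ⬝ᵥ (A *ᵥ x' - b) := by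
  have adj (y : ι → ℝ) (p : κ → ℝ) : y ⬝ᵥ (Aᵀ *ᵥ p) = p ⬝ᵥ (A *ᵥ y) := by
    rw [mulVec_transpose, dotProduct_comm, dotProduct_mulVec]
  simp only [dotProduct_neg, adj, mulVec_sub, sub_dotProduct, dotProduct_sub]
  ring

/-- Theorem 3.3 of the paper: from the key variational inequality with
`H(wᵏ − w^{k+1})` on the right-hand side, one deduces the inequality with
`H`-norm-induced distances. -/
theorem stmt_5 {m n : ℕ} (A : Matrix (Fin m) (Fin n) ℝ) (b : Fin m → ℝ)
    (θ : (Fin n → ℝ) → ℝ)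
    (H : Matrix (Fin n ⊕ Fin m) (Fin n ⊕ Fin m) ℝ) (hH : H.PosSemidef)
    (Ω : Set ((Fin n → ℝ) × (Fin m → ℝ)))
    (xn : Fin n → ℝ) (ln : Fin m → ℝ) (hmem : (xn, ln) ∈ Ω)
    (xk : Fin n → ℝ) (lk : Fin m → ℝ)
    (hvi : ∀ w ∈ Ω,
      θ w.1 - θ xn + ((w.1 - xn) ⬝ᵥ (-(Aᵀ *ᵥ ln)) + (w.2 - ln) ⬝ᵥ (A *ᵥ xn - b)) ≥
        Sum.elim (w.1 - xn) (w.2 - ln) ⬝ᵥ (H *ᵥ Sum.elim (xk - xn) (lk - ln))) :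
    ∀ w ∈ Ω,
      θ w.1 - θ xn + ((w.1 - xn) ⬝ᵥ (-(Aᵀ *ᵥ w.2)) + (w.2 - ln) ⬝ᵥ (A *ᵥ w.1 - b)) ≥
        1 / 2 * (quadH H (Sum.elim (w.1 - xn) (w.2 - ln)) -
            quadH H (Sum.elim (w.1 - xk) (w.2 - lk))) +
          1 / 2 * quadH H (Sum.elim (xk - xn) (lk - ln)) := by
  intro w hw
  have hdiff : Sum.elim (w.1 - xk) (w.2 - lk) =
      Sum.elim (w.1 - xn) (w.2 - ln) - Sum.elim (xk - xn) (lk - ln) := by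
    ext (i | i) <;> simp
  have hsymm : H.IsSymm := isHermitian_iff_isSymm.mp hH.isHermitian
  rw [dotProduct_affine_skew, hdiff, quadH_sub hsymm]
  linarith [hvi w hw]
end

section
/- Let H be a symmetric positive semidefinite (n+m)×(n+m) matrix, θ : ℝⁿ → ℝ, F(x, λ) := (−Aᵀλ, Ax − b), and Ω ⊆ ℝⁿ × ℝᵐ. Suppose w^{k+1} = (x^{k+1}, λ^{k+1}) ∈ Ω and wᵏ satisfy, for all w = (x, λ) ∈ Ω, θ(x) − θ(x^{k+1}) + ⟨w − w^{k+1}, F(w)⟩ ≥ (1/2)(‖w − w^{k+1}‖²_H − ‖w − wᵏ‖²_H) + (1/2)‖wᵏ − w^{k+1}‖²_H. Let w* = (x*, λ*) ∈ Ω be a solution of the variational inequality, i.e. θ(x) − θ(x*) + ⟨w − w*, F(w*)⟩ ≥ 0 for all w = (x, λ) ∈ Ω. Then ‖w^{k+1} − w*‖²_H ≤ ‖wᵏ − w*‖²_H − ‖wᵏ − w^{k+1}‖²_H. -/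
open Matrix

theorem quadH_sumElim_neg {α β : Type*} [Fintype α] [Fintype β]
    (H : Matrix (α ⊕ β) (α ⊕ β) ℝ) (u : α → ℝ) (v : β → ℝ) :
    quadH H (Sum.elim (-u) (-v)) = quadH H (Sum.elim u v) := by
  simp [quadH, Sum.elim_neg_neg, mulVec_neg]

/-- Theorem 3.4 of the paper: the contraction inequality
`‖w^{k+1} − w*‖²_H ≤ ‖wᵏ − w*‖²_H − ‖wᵏ − w^{k+1}‖²_H` for any VI solution `w*`. -/
theorem stmt_6 {m n : ℕ} (A : Matrix (Fin m) (Fin n) ℝ) (b : Fin m → ℝ)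
    (θ : (Fin n → ℝ) → ℝ)
    (H : Matrix (Fin n ⊕ Fin m) (Fin n ⊕ Fin m) ℝ) (hH : H.PosSemidef)
    (Ω : Set ((Fin n → ℝ) × (Fin m → ℝ)))
    (xn : Fin n → ℝ) (ln : Fin m → ℝ) (hmem : (xn, ln) ∈ Ω)
    (xk : Fin n → ℝ) (lk : Fin m → ℝ)
    (hineq : ∀ w ∈ Ω,
      θ w.1 - θ xn + ((w.1 - xn) ⬝ᵥ (-(Aᵀ *ᵥ w.2)) + (w.2 - ln) ⬝ᵥ (A *ᵥ w.1 - b)) ≥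
        1 / 2 * (quadH H (Sum.elim (w.1 - xn) (w.2 - ln)) -
            quadH H (Sum.elim (w.1 - xk) (w.2 - lk))) +
          1 / 2 * quadH H (Sum.elim (xk - xn) (lk - ln)))
    (xs : Fin n → ℝ) (ls : Fin m → ℝ) (hsmem : (xs, ls) ∈ Ω)
    (hsol : ∀ w ∈ Ω,
      θ w.1 - θ xs + ((w.1 - xs) ⬝ᵥ (-(Aᵀ *ᵥ ls)) + (w.2 - ls) ⬝ᵥ (A *ᵥ xs - b)) ≥ 0) :
    quadH H (Sum.elim (xn - xs) (ln - ls)) ≤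
      quadH H (Sum.elim (xk - xs) (lk - ls)) - quadH H (Sum.elim (xk - xn) (lk - ln)) := by
  have hn := hineq (xs, ls) hsmem
  have hs := hsol (xn, ln) hmem
  dsimp only at hn hs
  rw [← neg_sub xn xs, ← neg_sub ln ls, neg_dotProduct, neg_dotProduct,
    quadH_sumElim_neg, ← neg_sub xk xs, ← neg_sub lk ls, quadH_sumElim_neg] at hn
  linarith
end

section
/- Let A ∈ ℝ^{m×n}, b ∈ ℝᵐ, θ : ℝⁿ → ℝ continuous and convex, X ⊆ ℝⁿ closed convex, Λ ⊆ ℝᵐ closed convex, and let Ω = X × Λ and F(x, λ) = (−Aᵀλ, Ax − b). Let H be the symmetric positive definite matrix H = [[r Iₙ, Aᵀ], [A, (1/r)AAᵀ + δ Iₘ]] with r > 0, δ > 0. Let {wᵏ = (xᵏ, λᵏ)} be a sequence with wᵏ ∈ Ω for k ≥ 1 satisfying, for every k, θ(x) − θ(x^{k+1}) + ⟨w − w^{k+1}, F(w^{k+1})⟩ ≥ ⟨w − w^{k+1}, H(wᵏ − w^{k+1})⟩ for all w = (x, λ) ∈ Ω, and suppose the solution set Ω* of the variational inequality (find w* ∈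 Ω with θ(x) − θ(x*) + ⟨w − w*, F(w*)⟩ ≥ 0 for all w ∈ Ω) is nonempty. Then {wᵏ} converges to some point w^∞ ∈ Ω*. -/
open Matrix

open Filter Topology

/-- A continuous, positive definite, 2-homogeneous function on a finite-dimensional space
dominates a multiple of the squared norm. -/
lemma exists_pos_mul_sq_norm_le {E : Type*} [NormedAddCommGroup E] [NormedSpace ℝ E]
    [ProperSpace E] {Q : E → ℝ} (hQ : Continuous Q) (hpos : ∀ d, d ≠ 0 → 0 < Q d)
    (hhom : ∀ (t : ℝ) d, Q (t • d) = t ^ 2 * Q d) :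
    ∃ c > 0, ∀ d, c * ‖d‖ ^ 2 ≤ Q d := by
  have hzero : Q 0 = 0 := by simpa using hhom 0 0
  rcases (Metric.sphere (0 : E) 1).eq_empty_or_nonempty with hS | hS
  · refine ⟨1, one_pos, fun d => ?_⟩
    have hd : d = 0 := by
      by_contra hd
      have : ‖d‖⁻¹ • d ∈ Metric.sphere (0 : E) 1 := by
        simp [norm_smul, norm_ne_zero_iff.mpr hd]
      simp [hS] at this
    simp [hd, hzero]
  · obtain ⟨p, hp, hmin⟩ := (isCompact_sphere (0 : E) 1).exists_isMinOn hS hQ.continuousOn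
    have hp0 : p ≠ 0 := by
      rintro rfl
      simp at hp
    refine ⟨Q p, hpos p hp0, fun d => ?_⟩
    by_cases hd : d = 0
    · simp [hd, hzero]
    have hn : ‖d‖ ≠ 0 := norm_ne_zero_iff.mpr hd
    have hmem : ‖d‖⁻¹ • d ∈ Metric.sphere (0 : E) 1 := by
      simp [norm_smul, hn]
    have hle : Q p ≤ Q (‖d‖⁻¹ • d) := hmin hmem
    calc Q p * ‖d‖ ^ 2 ≤ Q (‖d‖⁻¹ • d) * ‖d‖ ^ 2 := by gcongr
      _ = Q d := by
        rw [hhom]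
        field_simp

lemma tendsto_zero_of_mul_sq_norm_le {ι E : Type*} [NormedAddCommGroup E] {Q : E → ℝ} {c : ℝ}
    (hc : 0 < c) (hQ : ∀ d, c * ‖d‖ ^ 2 ≤ Q d) {l : Filter ι} {v : ι → E}
    (hv : Tendsto (fun i => Q (v i)) l (𝓝 0)) : Tendsto v l (𝓝 0) := by
  rw [tendsto_zero_iff_norm_tendsto_zero]
  have hsq : Tendsto (fun i => ‖v i‖ ^ 2) l (𝓝 0) := by
    refine squeeze_zero (fun i => by positivity) (fun i => ?_)
      (by simpa using hv.const_mul c⁻¹)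
    rw [inv_mul_eq_div, le_div_iff₀ hc, mul_comm]
    exact hQ _
  simpa using hsq.sqrt

/-- A sequence which is strictly Fejér monotone with respect to a nonempty set `S`, and whose
cluster points all lie in `S`, converges to a point of `S`. -/
lemma exists_tendsto_of_fejer {E : Type*} [NormedAddCommGroup E] [ProperSpace E]
    {Q : E → ℝ} (hQ : Continuous Q) (hQ0 : Q 0 = 0) {c : ℝ} (hc : 0 < c)
    (hcoer : ∀ d, c * ‖d‖ ^ 2 ≤ Q d) {w : ℕ → E} {S : Set E} (hS : S.Nonempty)
    (hfejer : ∀ s ∈ S, ∀ k, Q (w (k + 1) - s) + Q (w k - w (k + 1)) ≤ Q (w k - s))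
    (hcluster : Tendsto (fun k => w k - w (k + 1)) atTop (𝓝 0) →
      ∀ (φ : ℕ → ℕ) (p : E), StrictMono φ → Tendsto (w ∘ φ) atTop (𝓝 p) → p ∈ S) :
    ∃ p ∈ S, Tendsto w atTop (𝓝 p) := by
  have hnn : ∀ d, 0 ≤ Q d := fun d => (by positivity : 0 ≤ c * ‖d‖ ^ 2).trans (hcoer d)
  have hanti : ∀ s ∈ S, Antitone fun k => Q (w k - s) := fun s hs =>
    antitone_nat_of_succ_le fun k => by linarith [hfejer s hs k, hnn (w k - w (k + 1))]
  have hbdd : ∀ s, BddBelow (Set.range fun k => Q (w k - s)) := fun s =>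
    ⟨0, by rintro _ ⟨k, rfl⟩; exact hnn _⟩
  obtain ⟨s, hs⟩ := hS
  have hlim := tendsto_atTop_ciInf (hanti s hs) (hbdd s)
  have hdiff : Tendsto (fun k => w k - w (k + 1)) atTop (𝓝 0) := by
    refine tendsto_zero_of_mul_sq_norm_le hc hcoer ?_
    refine squeeze_zero (fun k => hnn _) (fun k => ?_)
      (by simpa using hlim.sub (hlim.comp (tendsto_add_atTop_nat 1)))
    linarith [hfejer s hs k]
  have hball : ∀ k, w k ∈ Metric.closedBall s (Real.sqrt (Q (w 0 - s) / c)) := fun k => by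
    rw [mem_closedBall_iff_norm]
    refine Real.le_sqrt_of_sq_le ?_
    rw [le_div_iff₀ hc, mul_comm]
    exact (hcoer _).trans (hanti s hs (Nat.zero_le k))
  obtain ⟨p, -, φ, hφ, hp⟩ := (isCompact_closedBall _ _).tendsto_subseq hball
  have hpS := hcluster hdiff φ p hφ hp
  refine ⟨p, hpS, ?_⟩
  have hlimp := tendsto_atTop_ciInf (hanti p hpS) (hbdd p)
  have hsub : Tendsto (fun k => Q (w (φ k) - p)) atTop (𝓝 0) := by
    have := (hQ.tendsto 0).comp (tendsto_sub_nhds_zero_iff.mpr hp)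
    rwa [hQ0] at this
  rw [tendsto_nhds_unique (hlimp.comp hφ.tendsto_atTop) hsub] at hlimp
  exact tendsto_sub_nhds_zero_iff.mp (tendsto_zero_of_mul_sq_norm_le hc hcoer hlimp)

/-- The bilinear form of the proximal matrix of the balanced ALM, as a sum of two weighted
dot products. -/
lemma balanced_form_eq {m n : ℕ} (A : Matrix (Fin m) (Fin n) ℝ) {r : ℝ} (hr : r ≠ 0) (δ : ℝ)
    (d e : (Fin n → ℝ) × (Fin m → ℝ)) :
    Sum.elim d.1 d.2 ⬝ᵥ (Matrix.fromBlocks (r • (1 : Matrix (Fin n) (Fin n) ℝ)) Aᵀ A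
      ((1 / r) • (A * Aᵀ) + δ • (1 : Matrix (Fin m) (Fin m) ℝ)) *ᵥ Sum.elim e.1 e.2) =
    (1 / r) * ((r • d.1 + Aᵀ *ᵥ d.2) ⬝ᵥ (r • e.1 + Aᵀ *ᵥ e.2)) + δ * (d.2 ⬝ᵥ e.2) := by
  have h (u : Fin m → ℝ) (v : Fin n → ℝ) : (Aᵀ *ᵥ u) ⬝ᵥ v = u ⬝ᵥ (A *ᵥ v) := by
    rw [Matrix.mulVec_transpose, Matrix.dotProduct_mulVec]
  simp only [Matrix.fromBlocks_mulVec, Sum.elim_comp_inl, Sum.elim_comp_inr,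
    sumElim_dotProduct_sumElim, Matrix.add_mulVec, Matrix.smul_mulVec, Matrix.one_mulVec,
    dotProduct_add, add_dotProduct, smul_dotProduct, dotProduct_smul, smul_eq_mul, h,
    Matrix.mulVec_mulVec]
  field_simp
  ring

/-- Theorem 3.5 of the paper: convergence of the sequence generated by
the balanced ALM to a solution of the variational inequality. -/
theorem stmt_8 {m n : ℕ} (A : Matrix (Fin m) (Fin n) ℝ) (b : Fin m → ℝ)
    (θ : (Fin n → ℝ) → ℝ) (hθcont : Continuous θ) (hθ : ConvexOn ℝ Set.univ θ)
    (X : Set (Fin n → ℝ)) (hXcl : IsClosed X) (hX : Convex ℝ X)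
    (Λ : Set (Fin m → ℝ)) (hΛcl : IsClosed Λ) (hΛ : Convex ℝ Λ)
    (r δ : ℝ) (hr : 0 < r) (hδ : 0 < δ)
    (H : Matrix (Fin n ⊕ Fin m) (Fin n ⊕ Fin m) ℝ)
    (hH : H = Matrix.fromBlocks (r • (1 : Matrix (Fin n) (Fin n) ℝ)) Aᵀ A
      ((1 / r) • (A * Aᵀ) + δ • (1 : Matrix (Fin m) (Fin m) ℝ)))
    (w : ℕ → (Fin n → ℝ) × (Fin m → ℝ))
    (hmem : ∀ k ≥ 1, w k ∈ X ×ˢ Λ)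
    (hkey : ∀ k, ∀ u ∈ X ×ˢ Λ,
      θ u.1 - θ (w (k + 1)).1 +
          ((u.1 - (w (k + 1)).1) ⬝ᵥ (-(Aᵀ *ᵥ (w (k + 1)).2)) +
            (u.2 - (w (k + 1)).2) ⬝ᵥ (A *ᵥ (w (k + 1)).1 - b)) ≥
        Sum.elim (u.1 - (w (k + 1)).1) (u.2 - (w (k + 1)).2) ⬝ᵥ
          (H *ᵥ Sum.elim ((w k).1 - (w (k + 1)).1) ((w k).2 - (w (k + 1)).2)))
    (hsol : ∃ ws ∈ X ×ˢ Λ, ∀ u ∈ X ×ˢ Λ,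
      θ u.1 - θ ws.1 +
        ((u.1 - ws.1) ⬝ᵥ (-(Aᵀ *ᵥ ws.2)) + (u.2 - ws.2) ⬝ᵥ (A *ᵥ ws.1 - b)) ≥ 0) :
    ∃ winf ∈ X ×ˢ Λ,
      (∀ u ∈ X ×ˢ Λ,
        θ u.1 - θ winf.1 +
          ((u.1 - winf.1) ⬝ᵥ (-(Aᵀ *ᵥ winf.2)) + (u.2 - winf.2) ⬝ᵥ (A *ᵥ winf.1 - b)) ≥ 0) ∧
      Filter.Tendsto w Filter.atTop (nhds winf) := by
  set B : (Fin n → ℝ) × (Fin m → ℝ) → (Fin n → ℝ) × (Fin m → ℝ) → ℝ := fun d e =>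
    (1 / r) * ((r • d.1 + Aᵀ *ᵥ d.2) ⬝ᵥ (r • e.1 + Aᵀ *ᵥ e.2)) + δ * (d.2 ⬝ᵥ e.2) with hB
  have hprox : ∀ k, ∀ u ∈ X ×ˢ Λ, B (u - w (k + 1)) (w k - w (k + 1)) ≤
      θ u.1 - θ (w (k + 1)).1 +
        ((u.1 - (w (k + 1)).1) ⬝ᵥ (-(Aᵀ *ᵥ (w (k + 1)).2)) +
          (u.2 - (w (k + 1)).2) ⬝ᵥ (A *ᵥ (w (k + 1)).1 - b)) := fun k u hu => by
    have h := hkey k u hu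
    rw [hH] at h
    exact (balanced_form_eq A hr.ne' δ (u - w (k + 1)) (w k - w (k + 1))).symm.trans_le h
  have hBcont : Continuous fun p : ((Fin n → ℝ) × (Fin m → ℝ)) × ((Fin n → ℝ) × (Fin m → ℝ)) =>
      B p.1 p.2 := by
    fun_prop
  have hQcont : Continuous fun d => B d d := hBcont.comp (continuous_id.prodMk continuous_id)
  have hpos : ∀ d, d ≠ 0 → 0 < B d d := fun d hd => by
    have h₁ : 0 ≤ (r • d.1 + Aᵀ *ᵥ d.2) ⬝ᵥ (r • d.1 + Aᵀ *ᵥ d.2) := by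
      simpa using dotProduct_star_self_nonneg (r • d.1 + Aᵀ *ᵥ d.2)
    have h₂ : 0 ≤ d.2 ⬝ᵥ d.2 := by simpa using dotProduct_star_self_nonneg d.2
    have hr' : 0 < 1 / r := by positivity
    by_cases hd₂ : d.2 = 0
    · have hd₁ : d.1 ≠ 0 := fun h => hd (Prod.ext h hd₂)
      have h₃ : r • d.1 + Aᵀ *ᵥ d.2 ≠ 0 := by simp [hd₂, hd₁, hr.ne']
      have h₄ := h₁.lt_of_ne' (mt dotProduct_self_eq_zero.mp h₃)
      exact add_pos_of_pos_of_nonneg (mul_pos hr' h₄) (mul_nonneg hδ.le h₂)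
    · have h₄ := h₂.lt_of_ne' (mt dotProduct_self_eq_zero.mp hd₂)
      exact add_pos_of_nonneg_of_pos (mul_nonneg hr'.le h₁) (mul_pos hδ h₄)
  have hhom : ∀ (t : ℝ) d, B (t • d) (t • d) = t ^ 2 * B d d := fun t d => by
    simp only [hB, Prod.smul_fst, Prod.smul_snd, Matrix.mulVec_smul, smul_comm r t, ← smul_add,
      smul_dotProduct, dotProduct_smul, smul_eq_mul]
    ring
  obtain ⟨c, hc, hcoer⟩ := exists_pos_mul_sq_norm_le hQcont hpos hhom
  have hskew (p q : (Fin n → ℝ) × (Fin m → ℝ)) :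
      ((p.1 - q.1) ⬝ᵥ (-(Aᵀ *ᵥ q.2)) + (p.2 - q.2) ⬝ᵥ (A *ᵥ q.1 - b)) +
        ((q.1 - p.1) ⬝ᵥ (-(Aᵀ *ᵥ p.2)) + (q.2 - p.2) ⬝ᵥ (A *ᵥ p.1 - b)) = 0 := by
    have h (u : Fin m → ℝ) (v : Fin n → ℝ) : v ⬝ᵥ (Aᵀ *ᵥ u) = u ⬝ᵥ (A *ᵥ v) := by
      rw [dotProduct_comm, Matrix.mulVec_transpose, Matrix.dotProduct_mulVec]
    simp only [dotProduct_neg, dotProduct_sub, sub_dotProduct, h, Matrix.mulVec_sub]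
    ring
  have hcomm (p q) : B p q = B q p := by
    simp only [hB, dotProduct_comm (r • p.1 + _), dotProduct_comm p.2]
  have hsub (p q s) : B (p - q) s = B p s - B q s := by
    simp only [hB, Prod.fst_sub, Prod.snd_sub, Matrix.mulVec_sub, smul_sub, add_dotProduct,
      sub_dotProduct]
    ring
  have hpolar (p q s) :
      B (p - s) (p - s) = B (q - s) (q - s) + B (p - q) (p - q) - 2 * B (s - q) (p - q) := by
    simp only [hsub, hcomm _ (_ - _)]
    linarith [hcomm p q, hcomm p s, hcomm q s]
  obtain ⟨p, ⟨hpmem, hpsol⟩, hlim⟩ := exists_tendsto_of_fejer (w := w)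
    (S := {p | p ∈ X ×ˢ Λ ∧ ∀ u ∈ X ×ˢ Λ, θ u.1 - θ p.1 +
      ((u.1 - p.1) ⬝ᵥ (-(Aᵀ *ᵥ p.2)) + (u.2 - p.2) ⬝ᵥ (A *ᵥ p.1 - b)) ≥ 0})
    hQcont (by simp [hB]) hc hcoer hsol
    (fun s hs k => by
      have h₁ := hprox k s hs.1
      have h₂ := hs.2 (w (k + 1)) (hmem _ (Nat.le_add_left 1 k))
      linarith [hpolar (w k) (w (k + 1)) s, hskew s (w (k + 1))])
    (fun hdiff φ p hφ hp => by
      have hstep : Tendsto (fun k => w (φ k) - w (φ k + 1)) atTop (𝓝 0) :=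
        hdiff.comp hφ.tendsto_atTop
      have hnext : Tendsto (fun k => w (φ k + 1)) atTop (𝓝 p) := by
        simpa using Tendsto.sub hp hstep
      refine ⟨(hXcl.prod hΛcl).mem_of_tendsto hnext
        (Eventually.of_forall fun k => hmem _ (Nat.le_add_left 1 _)), fun u hu => ?_⟩
      have hl : Tendsto (fun k => B (u - w (φ k + 1)) (w (φ k) - w (φ k + 1))) atTop (𝓝 0) := by
        have := (hBcont.tendsto (u - p, 0)).comp ((hnext.const_sub u).prodMk_nhds hstep)
        simpa [hB, Function.comp_def] using this
      have hcont : Continuous fun q : (Fin n → ℝ) × (Fin m → ℝ) => θ u.1 - θ q.1 +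
          ((u.1 - q.1) ⬝ᵥ (-(Aᵀ *ᵥ q.2)) + (u.2 - q.2) ⬝ᵥ (A *ᵥ q.1 - b)) := by
        fun_prop
      exact le_of_tendsto_of_tendsto' hl ((hcont.tendsto p).comp hnext)
        fun k => hprox (φ k) u hu)
  exact ⟨p, hpmem, hpsol, hlim⟩
end

section
/- Let H be a symmetric positive semidefinite matrix on ℝ^{n+m}, θ : ℝⁿ → ℝ convex, F(x, λ) := (−Aᵀλ, Ax − b), and Ω = X × Λ ⊆ ℝⁿ × ℝᵐ a convex set. Let {wᵏ = (xᵏ, λᵏ)} be a sequence with w^{k+1} ∈ Ω satisfying, for every k ≥ 0 and all w = (x, λ) ∈ Ω, θ(x) − θ(x^{k+1}) + ⟨w − w^{k+1}, F(w)⟩ ≥ (1/2)(‖w − w^{k+1}‖²_H − ‖w − wᵏ‖²_H) + (1/2)‖wᵏ − w^{k+1}‖²_H. For an integer t > 0 define the ergodic average w̃ₜ = (1/(t+1)) Σ_{k=0}^{t} w^{k+1}, with first component x̃ₜ = (1/(t+1)) Σ_{k=0}^{t} x^{k+1}. Then w̃ₜ ∈ Ω and, for all w = (x, λ) ∈ Ω,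 θ(x̃ₜ) − θ(x) + ⟨w̃ₜ − w, F(w)⟩ ≤ (1/(2(t+1))) ‖w − w⁰‖²_H. -/
open Matrix

/-- An affine perturbation of a convex function of the first component is convex on the product. -/
theorem convexOn_fst_add_dotProduct {m n : ℕ} {θ : (Fin n → ℝ) → ℝ}
    (hθ : ConvexOn ℝ Set.univ θ) (u : (Fin n → ℝ) × (Fin m → ℝ))
    (p : Fin n → ℝ) (q : Fin m → ℝ) :
    ConvexOn ℝ Set.univ fun v : (Fin n → ℝ) × (Fin m → ℝ) =>
      θ v.1 - θ u.1 + ((v.1 - u.1) ⬝ᵥ p + (v.2 - u.2) ⬝ᵥ q) := by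
  refine ⟨convex_univ, fun v _ v' _ a c ha hc hac => ?_⟩
  have h := hθ.2 (Set.mem_univ v.1) (Set.mem_univ v'.1) ha hc hac
  obtain rfl : c = 1 - a := by linarith
  simp only [Prod.fst_add, Prod.snd_add, Prod.smul_fst, Prod.smul_snd, sub_dotProduct,
    add_dotProduct, smul_dotProduct, smul_eq_mul] at h ⊢
  linarith

/-- Theorem 3.6 of the paper: the worst-case `O(1/t)` ergodic convergence
rate of the balanced ALM. -/
theorem stmt_9 {m n : ℕ} (A : Matrix (Fin m) (Fin n) ℝ) (b : Fin m → ℝ)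
    (θ : (Fin n → ℝ) → ℝ) (hθ : ConvexOn ℝ Set.univ θ)
    (H : Matrix (Fin n ⊕ Fin m) (Fin n ⊕ Fin m) ℝ) (hH : H.PosSemidef)
    (X : Set (Fin n → ℝ)) (hX : Convex ℝ X)
    (Λ : Set (Fin m → ℝ)) (hΛ : Convex ℝ Λ)
    (w : ℕ → (Fin n → ℝ) × (Fin m → ℝ))
    (hmem : ∀ k, w (k + 1) ∈ X ×ˢ Λ)
    (hkey : ∀ k, ∀ u ∈ X ×ˢ Λ,
      θ u.1 - θ (w (k + 1)).1 +
          ((u.1 - (w (k + 1)).1) ⬝ᵥ (-(Aᵀ *ᵥ u.2)) +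
            (u.2 - (w (k + 1)).2) ⬝ᵥ (A *ᵥ u.1 - b)) ≥
        1 / 2 * (quadH H (Sum.elim (u.1 - (w (k + 1)).1) (u.2 - (w (k + 1)).2)) -
            quadH H (Sum.elim (u.1 - (w k).1) (u.2 - (w k).2))) +
          1 / 2 * quadH H (Sum.elim ((w k).1 - (w (k + 1)).1) ((w k).2 - (w (k + 1)).2)))
    (t : ℕ) (ht : 0 < t)
    (wt : (Fin n → ℝ) × (Fin m → ℝ))
    (hwt : wt = ((t : ℝ) + 1)⁻¹ • ∑ k ∈ Finset.range (t + 1), w (k + 1)) :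
    wt ∈ X ×ˢ Λ ∧
      ∀ u ∈ X ×ˢ Λ,
        θ wt.1 - θ u.1 +
            ((wt.1 - u.1) ⬝ᵥ (-(Aᵀ *ᵥ u.2)) + (wt.2 - u.2) ⬝ᵥ (A *ᵥ u.1 - b)) ≤
          1 / (2 * ((t : ℝ) + 1)) *
            quadH H (Sum.elim (u.1 - (w 0).1) (u.2 - (w 0).2)) := by
  have ht0 : (0 : ℝ) < (t : ℝ) + 1 := by positivity
  have hsum : ∑ _k ∈ Finset.range (t + 1), ((t : ℝ) + 1)⁻¹ = 1 := by
    rw [Finset.sum_const, Finset.card_range, nsmul_eq_mul]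
    push_cast
    exact mul_inv_cancel₀ ht0.ne'
  rw [Finset.smul_sum] at hwt
  refine ⟨?_, fun u hu => ?_⟩
  · rw [hwt]
    exact (hX.prod hΛ).sum_mem (fun _ _ => by positivity) hsum fun k _ => hmem k
  · have hjensen := (convexOn_fst_add_dotProduct hθ u (-(Aᵀ *ᵥ u.2)) (A *ᵥ u.1 - b)).map_sum_le
      (t := Finset.range (t + 1)) (w := fun _ => ((t : ℝ) + 1)⁻¹) (p := fun k => w (k + 1))
      (fun _ _ => by positivity) hsum fun _ _ => Set.mem_univ _
    rw [← hwt, ← Finset.smul_sum, smul_eq_mul] at hjensen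
    refine hjensen.trans ?_
    have hnonneg : ∀ v, 0 ≤ quadH H v := fun v => by
      simpa [quadH] using hH.dotProduct_mulVec_nonneg v
    have hstep := Finset.sum_le_sum fun k (_ : k ∈ Finset.range (t + 1)) =>
      show θ (w (k + 1)).1 - θ u.1 + (((w (k + 1)).1 - u.1) ⬝ᵥ (-(Aᵀ *ᵥ u.2)) +
          ((w (k + 1)).2 - u.2) ⬝ᵥ (A *ᵥ u.1 - b)) ≤
        1 / 2 * quadH H (Sum.elim (u.1 - (w k).1) (u.2 - (w k).2)) -
          1 / 2 * quadH H (Sum.elim (u.1 - (w (k + 1)).1) (u.2 - (w (k + 1)).2)) by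
      have h := hkey k u hu
      have h' := hnonneg (Sum.elim ((w k).1 - (w (k + 1)).1) ((w k).2 - (w (k + 1)).2))
      rw [← neg_sub u.1, ← neg_sub u.2, neg_dotProduct, neg_dotProduct]
      linarith
    rw [Finset.sum_range_sub'
      fun k => 1 / 2 * quadH H (Sum.elim (u.1 - (w k).1) (u.2 - (w k).2))] at hstep
    have hlast := hnonneg (Sum.elim (u.1 - (w (t + 1)).1) (u.2 - (w (t + 1)).2))
    calc _ ≤ ((t : ℝ) + 1)⁻¹ * (1 / 2 * quadH H (Sum.elim (u.1 - (w 0).1) (u.2 - (w 0).2))) := by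
          gcongr
          linarith
      _ = _ := by
          field_simp
end

section
/- Let p ≥ 1, A_i ∈ ℝ^{m×n_i}, b ∈ ℝᵐ, θ_i : ℝ^{n_i} → ℝ convex, X_i ⊆ ℝ^{n_i} convex for i = 1, …, p, and Λ ⊆ ℝᵐ convex. Let r_i > 0, δ > 0, H_p = Σ_{i=1}^{p} (1/r_i) A_i A_iᵀ + δ Iₘ, and let H be the block matrix with diagonal blocks r₁I_{n₁}, …, r_pI_{n_p}, H_p, last block row (A₁, …, A_p) and last block column (A₁ᵀ, …, A_pᵀ)ᵀ, all other off-diagonal blocks zero. Suppose wᵏ = (x₁ᵏ, …, x_pᵏ, λᵏ) is given and w^{k+1} = (x₁^{k+1}, …, x_p^{k+1}, λ^{k+1}) satisfies: for each i, x_i^{k+1} ∈ X_i and θ_i(x_i) − θ_i(x_i^{k+1}) + ⟨x_i − x_i^{k+1}, −A_iᵀλᵏ + r_i(x_i^{k+1} − x_iᵏ)⟩ ≥ 0 for all x_i ∈ X_i; and λ^{k+1} ∈ Λ with ⟨λ − λ^{k+1}, (Σ_{i=1}^{p} A_i(2x_i^{k+1} − x_iᵏ) − b) + H_p(λ^{k+1}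 − λᵏ)⟩ ≥ 0 for all λ ∈ Λ. Then, with θ(x) := Σ_{i=1}^{p} θ_i(x_i), F(x₁,…,x_p,λ) := (−A₁ᵀλ, …, −A_pᵀλ, Σ_{i=1}^{p} A_i x_i − b), and Ω := X₁ × ⋯ × X_p × Λ, one has w^{k+1} ∈ Ω and θ(x) − θ(x^{k+1}) + ⟨w − w^{k+1}, F(w^{k+1})⟩ ≥ ⟨w − w^{k+1}, H(wᵏ − w^{k+1})⟩ for all w ∈ Ω. -/
open Matrix

/-- Packing of a block vector `(x₁, …, x_p, λ)` into a single vector indexed by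
`(Σ i, Fin (n i)) ⊕ Fin m`. -/
def packVec {p m : ℕ} {n : Fin p → ℕ} (x : ∀ i, Fin (n i) → ℝ) (l : Fin m → ℝ) :
    (Σ i, Fin (n i)) ⊕ Fin m → ℝ :=
  Sum.elim (fun s => x s.1 s.2) l

theorem packVec_dotProduct_packVec {p m : ℕ} {n : Fin p → ℕ}
    (u v : ∀ i, Fin (n i) → ℝ) (d e : Fin m → ℝ) :
    packVec u d ⬝ᵥ packVec v e = (∑ i, u i ⬝ᵥ v i) + d ⬝ᵥ e := by
  simp [packVec, dotProduct, Fintype.sum_sum_type, Fintype.sum_sigma]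

theorem fromBlocks_mulVec_packVec {p m : ℕ} {n : Fin p → ℕ}
    (A : ∀ i, Matrix (Fin m) (Fin (n i)) ℝ) (r : Fin p → ℝ) (K : Matrix (Fin m) (Fin m) ℝ)
    (v : ∀ i, Fin (n i) → ℝ) (e : Fin m → ℝ) :
    Matrix.fromBlocks
      (Matrix.blockDiagonal' fun i => r i • (1 : Matrix (Fin (n i)) (Fin (n i)) ℝ))
      (Matrix.of fun s j => (A s.1)ᵀ s.2 j)
      (Matrix.of fun j s => A s.1 j s.2)
      K *ᵥ packVec v e =
    packVec (fun i => r i • v i + (A i)ᵀ *ᵥ e) ((∑ i, A i *ᵥ v i) + K *ᵥ e) := by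
  have hdiag : (Matrix.blockDiagonal' fun i => r i • (1 : Matrix (Fin (n i)) (Fin (n i)) ℝ)) =
      Matrix.diagonal fun s : Σ i, Fin (n i) => r s.1 := by
    simp only [Matrix.smul_one_eq_diagonal, Matrix.blockDiagonal'_diagonal]
  rw [hdiag, packVec, Matrix.fromBlocks_mulVec]
  funext s
  rcases s with s | j
  · simp only [packVec, Sum.elim_inl, Pi.add_apply, Sum.elim_comp_inl, Sum.elim_comp_inr,
      Matrix.mulVec_diagonal, Pi.smul_apply, smul_eq_mul]
    rfl
  · simp [packVec, Function.comp_def, Matrix.mulVec, dotProduct, Fintype.sum_sigma]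

/-- Theorem 4.2 of the paper: the key variational inequality for the
splitting version of the balanced ALM for the separable model
`min{Σᵢ θᵢ(xᵢ) : Σᵢ Aᵢxᵢ = b (or ≥ b), xᵢ ∈ Xᵢ}`. -/
theorem stmt_11 {p m : ℕ} (hp : 1 ≤ p) (n : Fin p → ℕ)
    (A : ∀ i, Matrix (Fin m) (Fin (n i)) ℝ) (b : Fin m → ℝ)
    (θ : ∀ i, (Fin (n i) → ℝ) → ℝ) (hθ : ∀ i, ConvexOn ℝ Set.univ (θ i))
    (X : ∀ i, Set (Fin (n i) → ℝ)) (hX : ∀ i, Convex ℝ (X i))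
    (Λ : Set (Fin m → ℝ)) (hΛ : Convex ℝ Λ)
    (r : Fin p → ℝ) (hr : ∀ i, 0 < r i) (δ : ℝ) (hδ : 0 < δ)
    (Hp : Matrix (Fin m) (Fin m) ℝ)
    (hHp : Hp = (∑ i, (1 / r i) • (A i * (A i)ᵀ)) + δ • (1 : Matrix (Fin m) (Fin m) ℝ))
    (H : Matrix ((Σ i, Fin (n i)) ⊕ Fin m) ((Σ i, Fin (n i)) ⊕ Fin m) ℝ)
    (hH : H = Matrix.fromBlocks
      (Matrix.blockDiagonal' fun i => r i • (1 : Matrix (Fin (n i)) (Fin (n i)) ℝ))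
      (Matrix.of fun s j => (A s.1)ᵀ s.2 j)
      (Matrix.of fun j s => A s.1 j s.2)
      Hp)
    (xk xn : ∀ i, Fin (n i) → ℝ) (lk ln : Fin m → ℝ)
    (hxn : ∀ i, xn i ∈ X i)
    (hxVI : ∀ i, ∀ xi ∈ X i,
      θ i xi - θ i (xn i) + (xi - xn i) ⬝ᵥ (-((A i)ᵀ *ᵥ lk) + r i • (xn i - xk i)) ≥ 0)
    (hln : ln ∈ Λ)
    (hlVI : ∀ l ∈ Λ,
      (l - ln) ⬝ᵥ (((∑ i, A i *ᵥ ((2 : ℝ) • xn i - xk i)) - b) + Hp *ᵥ (ln - lk)) ≥ 0) :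
    ∀ (x : ∀ i, Fin (n i) → ℝ), (∀ i, x i ∈ X i) → ∀ l ∈ Λ,
      (∑ i, θ i (x i)) - (∑ i, θ i (xn i)) +
          ((∑ i, (x i - xn i) ⬝ᵥ (-((A i)ᵀ *ᵥ ln))) +
            (l - ln) ⬝ᵥ ((∑ i, A i *ᵥ xn i) - b)) ≥
        packVec (fun i => x i - xn i) (l - ln) ⬝ᵥ
          (H *ᵥ packVec (fun i => xk i - xn i) (lk - ln)) := by
  intro x hx l hl
  rw [hH, fromBlocks_mulVec_packVec, packVec_dotProduct_packVec]
  have hprimal := Finset.sum_nonneg fun i (_ : i ∈ Finset.univ) => hxVI i (x i) (hx i)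
  have hdual := hlVI l hl
  simp only [Matrix.mulVec_sub, Matrix.mulVec_smul, dotProduct_add,
    dotProduct_sub, dotProduct_neg, dotProduct_smul, smul_sub, Finset.sum_add_distrib,
    Finset.sum_sub_distrib, Finset.sum_neg_distrib, ← Finset.smul_sum, smul_eq_mul] at hprimal hdual ⊢
  linarith
end

section
/- Let H be a symmetric positive semidefinite matrix on ℝ^{n+m}, θ : ℝⁿ → ℝ, F(x, λ) := (−Aᵀλ, Ax − b) for A ∈ ℝ^{m×n} and b ∈ ℝᵐ, and Ω ⊆ ℝⁿ × ℝᵐ. Suppose w̃ᵏ = (x̃ᵏ, λ̃ᵏ) ∈ Ω and wᵏ satisfy θ(x) − θ(x̃ᵏ) + ⟨w − w̃ᵏ, F(w̃ᵏ)⟩ ≥ ⟨w − w̃ᵏ, H(wᵏ − w̃ᵏ)⟩ for all w = (x, λ) ∈ Ω, let α ∈ (0, 2), and set w^{k+1} := wᵏ − α(wᵏ − w̃ᵏ). Then for every solution w* = (x*, λ*) ∈ Ω of the variational inequality (θ(x) − θ(x*) + ⟨w − w*, F(w*)⟩ ≥ 0 for all w ∈ Ω) one has ‖w^{k+1} − w*‖²_H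 ≤ ‖wᵏ − w*‖²_H − α(2 − α) ‖wᵏ − w̃ᵏ‖²_H. -/
open Matrix

theorem quadH_smul_add {α : Type*} [Fintype α] {H : Matrix α α ℝ} (hH : H.IsSymm)
    (c : ℝ) (d e : α → ℝ) :
    quadH H (c • d + e) = c ^ 2 * quadH H d + 2 * c * (e ⬝ᵥ (H *ᵥ d)) + quadH H e := by
  have hsymm : d ⬝ᵥ (H *ᵥ e) = e ⬝ᵥ (H *ᵥ d) := by
    rw [dotProduct_mulVec, ← mulVec_transpose, hH.eq, dotProduct_comm]
  simp only [quadH, mulVec_add, mulVec_smul, add_dotProduct, dotProduct_add, smul_dotProduct,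
    dotProduct_smul, smul_eq_mul, hsymm]
  ring

/-- The affine operator `(x, l) ↦ (-Aᵀ l, A x - b)` is skew. -/
theorem skew_operator_identity {m n : Type*} [Fintype m] [Fintype n] (A : Matrix m n ℝ)
    (b : m → ℝ) (x y : n → ℝ) (l k : m → ℝ) :
    ((x - y) ⬝ᵥ (-(Aᵀ *ᵥ k)) + (l - k) ⬝ᵥ (A *ᵥ y - b)) +
      ((y - x) ⬝ᵥ (-(Aᵀ *ᵥ l)) + (k - l) ⬝ᵥ (A *ᵥ x - b)) = 0 := by
  have h (u : n → ℝ) (v : m → ℝ) : u ⬝ᵥ (Aᵀ *ᵥ v) = v ⬝ᵥ (A *ᵥ u) := by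
    rw [mulVec_transpose, dotProduct_comm, ← dotProduct_mulVec]
  simp only [sub_dotProduct, dotProduct_sub, dotProduct_neg, h, mulVec_sub]
  ring

/-- the contraction inequality for the generalized (relaxed) version of
the balanced ALM:
`‖w^{k+1} − w*‖²_H ≤ ‖wᵏ − w*‖²_H − α(2 − α)‖wᵏ − w̃ᵏ‖²_H`. -/
theorem stmt_15 {m n : ℕ} (A : Matrix (Fin m) (Fin n) ℝ) (b : Fin m → ℝ)
    (θ : (Fin n → ℝ) → ℝ)
    (H : Matrix (Fin n ⊕ Fin m) (Fin n ⊕ Fin m) ℝ) (hH : H.PosSemidef)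
    (Ω : Set ((Fin n → ℝ) × (Fin m → ℝ)))
    (xt : Fin n → ℝ) (lt : Fin m → ℝ) (hmem : (xt, lt) ∈ Ω)
    (xk : Fin n → ℝ) (lk : Fin m → ℝ)
    (hvi : ∀ w ∈ Ω,
      θ w.1 - θ xt + ((w.1 - xt) ⬝ᵥ (-(Aᵀ *ᵥ lt)) + (w.2 - lt) ⬝ᵥ (A *ᵥ xt - b)) ≥
        Sum.elim (w.1 - xt) (w.2 - lt) ⬝ᵥ (H *ᵥ Sum.elim (xk - xt) (lk - lt)))
    (α : ℝ) (hα : α ∈ Set.Ioo (0 : ℝ) 2)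
    (xn : Fin n → ℝ) (ln : Fin m → ℝ)
    (hxn : xn = xk - α • (xk - xt)) (hln : ln = lk - α • (lk - lt))
    (xs : Fin n → ℝ) (ls : Fin m → ℝ) (hsmem : (xs, ls) ∈ Ω)
    (hsol : ∀ w ∈ Ω,
      θ w.1 - θ xs + ((w.1 - xs) ⬝ᵥ (-(Aᵀ *ᵥ ls)) + (w.2 - ls) ⬝ᵥ (A *ᵥ xs - b)) ≥ 0) :
    quadH H (Sum.elim (xn - xs) (ln - ls)) ≤
      quadH H (Sum.elim (xk - xs) (lk - ls)) -
        α * (2 - α) * quadH H (Sum.elim (xk - xt) (lk - lt)) := by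
  have hsymm : H.IsSymm := by simpa [IsHermitian, IsSymm] using hH.isHermitian
  set d : Fin n ⊕ Fin m → ℝ := Sum.elim (xk - xt) (lk - lt) with hd
  set e : Fin n ⊕ Fin m → ℝ := Sum.elim (xt - xs) (lt - ls) with he
  have hk : Sum.elim (xk - xs) (lk - ls) = (1 : ℝ) • d + e := by
    ext (i | i) <;> simp [hd, he]
  have hn : Sum.elim (xn - xs) (ln - ls) = (1 - α) • d + e := by
    ext (i | i) <;> simp [hd, he, hxn, hln] <;> ring
  have hneg : Sum.elim (xs - xt) (ls - lt) = -e := by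
    ext (i | i) <;> simp [he]
  have hcross : 0 ≤ e ⬝ᵥ (H *ᵥ d) := by
    have h₁ := hvi _ hsmem
    have h₂ := hsol _ hmem
    have h₃ := skew_operator_identity A b xs xt ls lt
    simp only [hneg, neg_dotProduct] at h₁ h₂
    linarith
  rw [hk, hn, quadH_smul_add hsymm, quadH_smul_add hsymm]
  nlinarith [mul_nonneg hα.1.le hcross]
end
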